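/- arXiv:2004.03058 — 2 statements merged into one kernel-verified Lean document; each statement's English description precedes it below -/
import Mathlib

section
/- Let s ∈ M_m be maximal, and let p be a monic irreducible factor of s of degree d with r = mult_p(s). (a) If d ≥ δ_q(m), then d ≥ log₂((r + 3)/(r + 2))·(d_{t+1}(s) − 1). (b) If d ≥ δ_q(m) − 1, then d ≥ log₂((r + 2)/(r + 1))·(d_{t+1}(s) − 1) − 1. -/
open Polynomial

/-- `Φ(s)`: the number of distinct monic divisors of `s` in `F[x]`. -/
noncomputable def numDiv {F : Type} [Field F] (s : F[X]) : ℕ :=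
  Set.ncard {d : F[X] | d.Monic ∧ d ∣ s}

/-- `s` is maximal in `M_m`: `s` is monic of degree exactly `m` and `Φ(s) = Υ_m`. -/
def IsMaximal {F : Type} [Field F] (m : ℕ) (s : F[X]) : Prop :=
  s.Monic ∧ s.natDegree = m ∧
    ∀ t : F[X], t.Monic → t.natDegree ≤ m → numDiv t ≤ numDiv s

/-- `d_{t+1}(s)`: the smallest positive integer `d` such that some monic irreducible
polynomial of degree `d` does not divide `s`. -/
noncomputable def dt1 {F : Type} [Field F] (s : F[X]) : ℕ :=
  sInf {d : ℕ | 0 < d ∧ ∃ p : F[X], p.Monic ∧ Irreducible p ∧ p.natDegree = d ∧ ¬ p ∣ s}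

/-- `I(d)`: the number of monic irreducible polynomials of degree `d` over `F`. -/
noncomputable def numIrred (F : Type) [Field F] (d : ℕ) : ℕ :=
  Set.ncard {p : F[X] | p.Monic ∧ Irreducible p ∧ p.natDegree = d}

/-- `δ_q(m)`: the smallest positive integer `δ` such that `I(d) > ⌊log_q m⌋ + 1` for every
`d ≥ δ`. -/
noncomputable def deltaQ (F : Type) [Field F] [Fintype F] (m : ℕ) : ℕ :=
  sInf {δ : ℕ | 0 < δ ∧ ∀ d : ℕ, δ ≤ d →
    ⌊Real.logb (Fintype.card F) m⌋₊ + 1 < numIrred F d}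

open UniqueFactorizationMonoid

section FiniteFields

variable {F : Type} [Field F] [Fintype F]

lemma monic_X_pow_card_pow_sub_X {n : ℕ} (hn : n ≠ 0) :
    (X ^ (Nat.card F) ^ n - X : F[X]).Monic := by
  apply Polynomial.monic_X_pow_sub
  rw [degree_X]
  exact_mod_cast Nat.one_lt_pow hn Finite.one_lt_card

lemma squarefree_X_pow_card_pow_sub_X {n : ℕ} (hn : n ≠ 0) :
    Squarefree (X ^ (Nat.card F) ^ n - X : F[X]) := by
  obtain ⟨p, hp⟩ := CharP.exists F
  refine (galois_poly_separable p _ ?_).squarefree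
  refine dvd_pow ?_ hn
  rw [← CharP.cast_eq_zero_iff F p]
  simp

open Classical in
/-- The monic irreducible polynomials whose degree divides `n`. -/
noncomputable def irredFactors (F : Type) [Field F] [Fintype F] (n : ℕ) : Finset F[X] :=
  (normalizedFactors (X ^ (Nat.card F) ^ n - X : F[X])).toFinset

lemma mem_irredFactors {n : ℕ} (hn : n ≠ 0) {f : F[X]} :
    f ∈ irredFactors F n ↔ Irreducible f ∧ f.Monic ∧ f.natDegree ∣ n := by
  classical
  rw [irredFactors, Multiset.mem_toFinset,
    Polynomial.mem_normalizedFactors_iff (monic_X_pow_card_pow_sub_X hn).ne_zero]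
  constructor
  · rintro ⟨h1, h2, h3⟩
    exact ⟨h1, h2, h1.natDegree_dvd_iff_dvd_X_pow_card_pow_sub_X.2 h3⟩
  · rintro ⟨h1, h2, h3⟩
    exact ⟨h1, h2, h1.natDegree_dvd_iff_dvd_X_pow_card_pow_sub_X.1 h3⟩

lemma prod_irredFactors {n : ℕ} (hn : n ≠ 0) :
    ∏ f ∈ irredFactors F n, f = X ^ (Nat.card F) ^ n - X := by
  classical
  have hm := monic_X_pow_card_pow_sub_X (F := F) hn
  have hnd := (squarefree_iff_nodup_normalizedFactors hm.ne_zero).1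
    (squarefree_X_pow_card_pow_sub_X (F := F) hn)
  have h := leadingCoeff_mul_prod_normalizedFactors (X ^ (Nat.card F) ^ n - X : F[X])
  rw [hm.leadingCoeff, C_1, one_mul] at h
  rw [← h, irredFactors, Finset.prod, Multiset.toFinset_val, hnd.dedup, Multiset.map_id']

lemma sum_natDegree_irredFactors {n : ℕ} (hn : n ≠ 0) :
    ∑ f ∈ irredFactors F n, f.natDegree = Nat.card F ^ n := by
  rw [← natDegree_prod_of_monic, prod_irredFactors hn,
    FiniteField.X_pow_card_pow_sub_X_natDegree_eq _ hn Finite.one_lt_card]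
  exact fun f hf ↦ ((mem_irredFactors hn).1 hf).2.1

lemma numIrred_eq_card {n : ℕ} (hn : n ≠ 0) :
    numIrred F n = ((irredFactors F n).filter (fun f ↦ f.natDegree = n)).card := by
  rw [numIrred, ← Set.ncard_coe_finset]
  congr 1
  ext f
  simp only [Set.mem_ofPred_eq, Finset.coe_filter, mem_irredFactors hn]
  constructor
  · rintro ⟨h1, h2, rfl⟩
    exact ⟨⟨h2, h1, dvd_rfl⟩, rfl⟩
  · rintro ⟨⟨h1, h2, -⟩, h3⟩
    exact ⟨h2, h1, h3⟩

lemma mul_numIrred_le {n : ℕ} (hn : n ≠ 0) : n * numIrred F n ≤ Nat.card F ^ n := by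
  rw [numIrred_eq_card hn, ← sum_natDegree_irredFactors hn, mul_comm,
    ← smul_eq_mul, ← Finset.sum_const]
  calc _ = ∑ f ∈ (irredFactors F n).filter (fun f ↦ f.natDegree = n), f.natDegree :=
        Finset.sum_congr rfl fun f hf ↦ (Finset.mem_filter.1 hf).2.symm
    _ ≤ _ := Finset.sum_le_sum_of_subset (Finset.filter_subset _ _)

lemma card_pow_le_sum_mul_numIrred {n : ℕ} (hn : n ≠ 0) :
    Nat.card F ^ n ≤ ∑ k ∈ n.divisors, k * numIrred F k := by
  rw [← sum_natDegree_irredFactors hn, ← Finset.sum_fiberwise_of_maps_to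
    (g := fun f : F[X] ↦ f.natDegree) (t := n.divisors)
    fun f hf ↦ Nat.mem_divisors.2 ⟨((mem_irredFactors hn).1 hf).2.2, hn⟩]
  refine Finset.sum_le_sum fun k hk ↦ ?_
  have hk0 : k ≠ 0 := (Nat.pos_of_mem_divisors hk).ne'
  rw [numIrred_eq_card hk0, mul_comm, ← smul_eq_mul, ← Finset.sum_const]
  rw [Finset.sum_congr rfl fun f hf ↦ (Finset.mem_filter.1 hf).2]
  refine Finset.sum_le_sum_of_subset fun f hf ↦ ?_
  rw [Finset.mem_filter, mem_irredFactors hn] at hf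
  rw [Finset.mem_filter, mem_irredFactors hk0]
  exact ⟨⟨hf.1.1, hf.1.2.1, hf.2.dvd⟩, hf.2⟩

lemma two_pow_le_mul_numIrred {n : ℕ} (hn : 4 ≤ n) : 2 ^ (n - 1) ≤ n * numIrred F n := by
  have hn0 : n ≠ 0 := by omega
  have hq : 2 ≤ Nat.card F := Finite.one_lt_card
  have h := card_pow_le_sum_mul_numIrred (F := F) hn0
  rw [← Nat.cons_self_properDivisors hn0, Finset.sum_cons] at h
  have h1 : ∑ k ∈ n.properDivisors, k * numIrred F k ≤ ∑ k ∈ Finset.range (n - 1),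
      Nat.card F ^ k := by
    refine (Finset.sum_le_sum fun k hk ↦
      mul_numIrred_le (Nat.pos_of_mem_properDivisors hk).ne').trans ?_
    refine Finset.sum_le_sum_of_subset fun k hk ↦ ?_
    rw [Nat.mem_properDivisors] at hk
    obtain ⟨⟨c, hc⟩, hlt⟩ := hk
    rw [Finset.mem_range]
    have : 2 ≤ c := by
      by_contra! hc'
      interval_cases c <;> omega
    have := Nat.mul_le_mul_left k this
    rw [← hc] at this
    omega
  have h2 : ∑ k ∈ Finset.range (n - 1), Nat.card F ^ k < Nat.card F ^ (n - 1) :=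
    Nat.geomSum_lt hq fun k hk ↦ Finset.mem_range.1 hk
  have h3 : 2 * Nat.card F ^ (n - 1) ≤ Nat.card F ^ n := by
    obtain ⟨k, rfl⟩ : ∃ k, n = k + 1 := ⟨n - 1, by omega⟩
    rw [pow_succ', Nat.add_sub_cancel]
    exact Nat.mul_le_mul_right _ hq
  have h4 : 2 ^ (n - 1) ≤ Nat.card F ^ (n - 1) := Nat.pow_le_pow_left hq _
  omega

lemma exists_forall_lt_numIrred (C : ℕ) : ∃ N : ℕ, ∀ n, N ≤ n → C < numIrred F n := by
  have h := tendsto_pow_const_div_const_pow_of_one_lt 1 (one_lt_two (α := ℝ))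
  have h' := h.eventually (gt_mem_nhds (show (0 : ℝ) < 1 / (2 * (C + 1)) by positivity))
  obtain ⟨N, hN⟩ := Filter.eventually_atTop.1 h'
  refine ⟨max N 4, fun n hn ↦ ?_⟩
  have h1 := hN n (le_of_max_le_left hn)
  have h4 : 4 ≤ n := le_of_max_le_right hn
  have h2 := two_pow_le_mul_numIrred (F := F) h4
  rw [pow_one, div_lt_div_iff₀ (by positivity) (by positivity), one_mul] at h1
  have h3 : n * (2 * (C + 1)) < 2 ^ n := by exact_mod_cast h1
  have h5 : 2 ^ n = 2 * 2 ^ (n - 1) := by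
    rw [← pow_succ', Nat.sub_add_cancel (by omega)]
  by_contra! hC
  have := Nat.mul_le_mul_left n hC
  nlinarith

lemma lt_numIrred_of_deltaQ_le {m d : ℕ} (hd : deltaQ F m ≤ d) :
    ⌊Real.logb (Fintype.card F) m⌋₊ + 1 < numIrred F d := by
  obtain ⟨N, hN⟩ := exists_forall_lt_numIrred (F := F) (⌊Real.logb (Fintype.card F) m⌋₊ + 1)
  have hne : {δ : ℕ | 0 < δ ∧ ∀ d : ℕ, δ ≤ d →
      ⌊Real.logb (Fintype.card F) m⌋₊ + 1 < numIrred F d}.Nonempty :=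
    ⟨N + 1, N.succ_pos, fun n hn ↦ hN n (by omega)⟩
  exact (Nat.sInf_mem hne).2 d hd

end FiniteFields

section DivisorCount

variable {F : Type} [Field F]

lemma numDiv_one : numDiv (1 : F[X]) = 1 := by
  rw [numDiv, Set.ncard_eq_one]
  refine ⟨1, Set.ext fun d ↦ ⟨fun h ↦ h.1.eq_one_of_isUnit (isUnit_of_dvd_one h.2), ?_⟩⟩
  rintro rfl
  exact ⟨monic_one, dvd_rfl⟩

lemma numDiv_pow_mul {p u : F[X]} (hp : p.Monic) (hpirr : Irreducible p) (hu : ¬ p ∣ u) (a : ℕ) :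
    numDiv (p ^ a * u) = (a + 1) * numDiv u := by
  have himage : {d : F[X] | d.Monic ∧ d ∣ p ^ a * u} =
      (fun x : ℕ × F[X] ↦ p ^ x.1 * x.2) ''
        ((Finset.range (a + 1) : Set ℕ) ×ˢ {d : F[X] | d.Monic ∧ d ∣ u}) := by
    ext d
    constructor
    · rintro ⟨hd, hdvd⟩
      obtain ⟨d₁, d₂, h₁, h₂, rfl⟩ := exists_dvd_and_dvd_of_dvd_mul hdvd
      obtain ⟨i, hi, hassoc⟩ := (dvd_prime_pow hpirr.prime a).1 h₁
      obtain ⟨v, hv⟩ := hassoc.symm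
      have hv' : d₁ * d₂ = p ^ i * (v * d₂) := by rw [← hv]; ring
      refine ⟨(i, v * d₂), ⟨?_, ?_, ?_⟩, hv'.symm⟩
      · simpa using hi
      · exact (hp.pow i).of_mul_monic_left (hv' ▸ hd)
      · exact (Units.mul_left_dvd).2 h₂
    · rintro ⟨⟨i, e⟩, ⟨hi, he, heu⟩, rfl⟩
      refine ⟨(hp.pow i).mul he, mul_dvd_mul (pow_dvd_pow p ?_) heu⟩
      simpa [Nat.lt_succ_iff] using hi
  have hinj : Set.InjOn (fun x : ℕ × F[X] ↦ p ^ x.1 * x.2)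
      ((Finset.range (a + 1) : Set ℕ) ×ˢ {d : F[X] | d.Monic ∧ d ∣ u}) := by
    have key : ∀ i j : ℕ, ∀ e e' : F[X], ¬ p ∣ e' → p ^ i * e = p ^ j * e' → i ≤ j := by
      intro i j e e' he' h
      by_contra! hij
      obtain ⟨k, rfl⟩ := Nat.exists_eq_add_of_lt hij
      have : p ^ j * (p * (p ^ k * e)) = p ^ j * e' := by rw [← h]; ring
      exact he' ⟨_, (mul_left_cancel₀ (pow_ne_zero j hp.ne_zero) this).symm⟩
    rintro ⟨i, e⟩ ⟨-, -, he⟩ ⟨j, e'⟩ ⟨-, -, he'⟩ h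
    dsimp only at h he he'
    have hij : i = j := le_antisymm (key i j e e' (fun hd ↦ hu (hd.trans he')) h)
      (key j i e' e (fun hd ↦ hu (hd.trans he)) h.symm)
    subst hij
    rw [mul_left_cancel₀ (pow_ne_zero i hp.ne_zero) h]
  rw [numDiv, himage, hinj.ncard_image, Set.ncard_prod, Set.ncard_coe_finset,
    Finset.card_range, numDiv]

lemma finiteMultiplicity_of_irreducible {p t : F[X]} (hpirr : Irreducible p) (ht : t ≠ 0) :
    FiniteMultiplicity p t :=
  FiniteMultiplicity.of_not_isUnit hpirr.not_isUnit ht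

lemma numDiv_mul_irreducible {p t : F[X]} (hp : p.Monic) (hpirr : Irreducible p) (ht : t ≠ 0) :
    numDiv (t * p) * (multiplicity p t + 1) = (multiplicity p t + 2) * numDiv t := by
  obtain ⟨u, hu, hpu⟩ :=
    (finiteMultiplicity_of_irreducible hpirr ht).exists_eq_pow_mul_and_not_dvd
  set a := multiplicity p t
  have h1 : t * p = p ^ (a + 1) * u := by rw [hu]; ring
  rw [h1, hu, numDiv_pow_mul hp hpirr hpu, numDiv_pow_mul hp hpirr hpu]
  ring

lemma multiplicity_eq_zero_of_ne {f g : F[X]} (hf : f.Monic) (hfirr : Irreducible f)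
    (hg : g.Monic) (hgirr : Irreducible g) (hne : f ≠ g) : multiplicity f g = 0 :=
  multiplicity_eq_zero.2 fun h ↦
    hne (eq_of_monic_of_associated hf hg (hfirr.associated_of_dvd hgirr h))

lemma multiplicity_mul_prod {f : F[X]} (hf : f.Monic) (hfirr : Irreducible f) {T : Finset F[X]}
    (hT : ∀ g ∈ T, g.Monic ∧ Irreducible g) (hfT : f ∉ T) {t : F[X]} (ht : t ≠ 0) :
    multiplicity f (t * ∏ g ∈ T, g) = multiplicity f t := by
  have hprod : ∏ g ∈ T, g ≠ 0 := Finset.prod_ne_zero_iff.2 fun g hg ↦ (hT g hg).1.ne_zero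
  rw [multiplicity_mul hfirr.prime
    (finiteMultiplicity_of_irreducible hfirr (mul_ne_zero ht hprod)), Nat.add_eq_left,
    multiplicity_eq_zero]
  intro h
  obtain ⟨g, hg, hfg⟩ := (hfirr.prime.dvd_finsetProd_iff _).1 h
  exact hfT (eq_of_monic_of_associated hf (hT g hg).1
    (hfirr.associated_of_dvd (hT g hg).2 hfg) ▸ hg)

lemma numDiv_mul_prod_le {T : Finset F[X]} (hT : ∀ g ∈ T, g.Monic ∧ Irreducible g)
    {t : F[X]} (ht : t ≠ 0) : numDiv (t * ∏ g ∈ T, g) ≤ 2 ^ T.card * numDiv t := by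
  classical
  induction T using Finset.induction_on with
  | empty => simp
  | insert f T hf ih =>
    have hT' : ∀ g ∈ T, g.Monic ∧ Irreducible g := fun g hg ↦ hT g (Finset.mem_insert_of_mem hg)
    have ih := ih hT'
    have hprod : t * ∏ g ∈ T, g ≠ 0 :=
      mul_ne_zero ht (Finset.prod_ne_zero_iff.2 fun g hg ↦ (hT' g hg).1.ne_zero)
    have hf' := hT f (Finset.mem_insert_self f T)
    have h := numDiv_mul_irreducible hf'.1 hf'.2 hprod
    rw [Finset.prod_insert hf, Finset.card_insert_of_notMem hf, mul_left_comm, mul_comm f, pow_succ]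
    set a := multiplicity f (t * ∏ g ∈ T, g)
    have h2 : numDiv (t * (∏ g ∈ T, g) * f) ≤ 2 * numDiv (t * ∏ g ∈ T, g) := by
      refine Nat.le_of_mul_le_mul_right (c := a + 1) ?_ a.succ_pos
      rw [h]
      nlinarith
    linarith

lemma pow_mul_numDiv_le {T : Finset F[X]} (hT : ∀ g ∈ T, g.Monic ∧ Irreducible g)
    {t : F[X]} (ht : t ≠ 0) {R : ℕ} (hR : ∀ g ∈ T, multiplicity g t ≤ R) :
    (R + 2) ^ T.card * numDiv t ≤ (R + 1) ^ T.card * numDiv (t * ∏ g ∈ T, g) := by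
  classical
  induction T using Finset.induction_on with
  | empty => simp
  | insert f T hf ih =>
    have hT' : ∀ g ∈ T, g.Monic ∧ Irreducible g := fun g hg ↦ hT g (Finset.mem_insert_of_mem hg)
    have ih := ih hT' fun g hg ↦ hR g (Finset.mem_insert_of_mem hg)
    have hprod : t * ∏ g ∈ T, g ≠ 0 :=
      mul_ne_zero ht (Finset.prod_ne_zero_iff.2 fun g hg ↦ (hT' g hg).1.ne_zero)
    have hf' := hT f (Finset.mem_insert_self f T)
    have h := numDiv_mul_irreducible hf'.1 hf'.2 hprod
    have hRf := hR f (Finset.mem_insert_self f T)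
    rw [multiplicity_mul_prod hf'.1 hf'.2 hT' hf ht] at h
    rw [Finset.prod_insert hf, Finset.card_insert_of_notMem hf, mul_left_comm, mul_comm f, pow_succ,
      pow_succ]
    set a := multiplicity f t
    set A := numDiv (t * ∏ g ∈ T, g)
    set B := numDiv (t * (∏ g ∈ T, g) * f)
    have h2 : (R + 2) * A ≤ (R + 1) * B := by
      refine Nat.le_of_mul_le_mul_right (c := a + 1) ?_ a.succ_pos
      calc (R + 2) * A * (a + 1) = (R + 2) * (a + 1) * A := by ring
        _ ≤ (R + 1) * (a + 2) * A := Nat.mul_le_mul_right _ (by nlinarith)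
        _ = (R + 1) * B * (a + 1) := by rw [mul_assoc, ← h]; ring
    calc (R + 2) ^ T.card * (R + 2) * numDiv t = (R + 2) * ((R + 2) ^ T.card * numDiv t) := by ring
      _ ≤ (R + 2) * ((R + 1) ^ T.card * A) := Nat.mul_le_mul_left _ ih
      _ = (R + 1) ^ T.card * ((R + 2) * A) := by ring
      _ ≤ (R + 1) ^ T.card * ((R + 1) * B) := Nat.mul_le_mul_left _ h2
      _ = _ := by ring

lemma IsMaximal.numDiv_pos {m : ℕ} {s : F[X]} (hs : IsMaximal m s) : 0 < numDiv s := by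
  have := hs.2.2 1 monic_one (by simp)
  rw [numDiv_one] at this
  omega

/-- In a maximal polynomial, an irreducible factor of larger degree has no larger multiplicity, and
the multiplicities of irreducible factors of equal degree differ by at most one. -/
lemma IsMaximal.multiplicity_le {m : ℕ} {s p g : F[X]} (hs : IsMaximal m s)
    (hp : p.Monic) (hpirr : Irreducible p) (hg : g.Monic) (hgirr : Irreducible g) :
    (p.natDegree ≤ g.natDegree → multiplicity g s ≤ multiplicity p s + 1) ∧
    (p.natDegree < g.natDegree → multiplicity g s ≤ multiplicity p s) := by
  by_cases hgs : g ∣ s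
  swap
  · simp [multiplicity_eq_zero.2 hgs]
  by_cases hpg : p = g
  · subst hpg
    simp
  obtain ⟨w, rfl⟩ := hgs
  have hwm : w.Monic := hg.of_mul_monic_left hs.1
  rw [mul_comm g w] at hs ⊢
  have hw0 := hwm.ne_zero
  have hfin : ∀ {f : F[X]}, Irreducible f → FiniteMultiplicity f (w * g) := fun hf ↦
    finiteMultiplicity_of_irreducible hf hs.1.ne_zero
  rw [multiplicity_mul hgirr.prime (hfin hgirr), multiplicity_self,
    multiplicity_mul hpirr.prime (hfin hpirr),
    multiplicity_eq_zero_of_ne hp hpirr hg hgirr hpg, add_zero]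
  have h1 := numDiv_mul_irreducible hg hgirr hw0
  have h2 := numDiv_mul_irreducible hp hpirr hw0
  have hpos := hs.numDiv_pos
  have hdeg : w.natDegree + g.natDegree = m := by rw [← hwm.natDegree_mul hg, hs.2.1]
  have hwp := hwm.mul hp
  have hwpdeg := hwm.natDegree_mul hp
  set c := multiplicity g w
  set r := multiplicity p w
  have hW : 0 < numDiv w := by
    by_contra! h0
    rw [Nat.le_zero.1 h0, mul_zero] at h1
    rcases Nat.mul_eq_zero.1 h1 with h | h <;> omega
  constructor
  · intro hle
    have h3 := hs.2.2 _ hwp (by omega)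
    have h4 : (r + 2) * (c + 1) * numDiv w ≤ (c + 2) * (r + 1) * numDiv w := by
      calc (r + 2) * (c + 1) * numDiv w = numDiv (w * p) * (r + 1) * (c + 1) := by rw [h2]; ring
        _ ≤ numDiv (w * g) * (r + 1) * (c + 1) := by gcongr
        _ = numDiv (w * g) * (c + 1) * (r + 1) := by ring
        _ = _ := by rw [h1]; ring
    have h5 := Nat.le_of_mul_le_mul_right h4 hW
    nlinarith
  · intro hlt
    have h3 := hs.2.2 (w * p * X) (hwp.mul monic_X) (by
      rw [hwp.natDegree_mul monic_X, natDegree_X]; omega)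
    have h6 := numDiv_mul_irreducible monic_X irreducible_X hwp.ne_zero
    have hpos' : 0 < numDiv (w * p) := by
      by_contra! h0
      rw [Nat.le_zero.1 h0, zero_mul] at h2
      rcases Nat.mul_eq_zero.1 h2.symm with h | h <;> omega
    have h3' : numDiv (w * p) < numDiv (w * g) := by
      refine lt_of_lt_of_le ?_ h3
      nlinarith
    have h4 : (r + 2) * (c + 1) * numDiv w < (c + 2) * (r + 1) * numDiv w := by
      calc (r + 2) * (c + 1) * numDiv w = numDiv (w * p) * (r + 1) * (c + 1) := by rw [h2]; ring
        _ < numDiv (w * g) * (r + 1) * (c + 1) := by gcongr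
        _ = numDiv (w * g) * (c + 1) * (r + 1) := by ring
        _ = _ := by rw [h1]; ring
    have h5 := Nat.lt_of_mul_lt_mul_right h4
    nlinarith

lemma dvd_of_natDegree_lt_dt1 {s f : F[X]} (hf : f.Monic) (hfirr : Irreducible f)
    (h : f.natDegree < dt1 s) : f ∣ s := by
  by_contra hfs
  exact Nat.notMem_of_lt_sInf h ⟨hfirr.natDegree_pos, f, hf, hfirr, rfl, hfs⟩

lemma prod_dvd_of_forall_dvd {T : Finset F[X]} {s : F[X]}
    (hT : ∀ g ∈ T, g.Monic ∧ Irreducible g) (h : ∀ g ∈ T, g ∣ s) : ∏ g ∈ T, g ∣ s := by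
  refine Finset.prod_dvd_of_coprime (fun f hf g hg hne ↦ ?_) h
  exact (hT f hf).2.coprime_iff_not_dvd.2 fun hd ↦ hne <| eq_of_monic_of_associated (hT f hf).1
    (hT g hg).1 ((hT f hf).2.associated_of_dvd (hT g hg).2 hd)

lemma natDegree_prod_of_forall_eq {T : Finset F[X]} {n : ℕ}
    (hT : ∀ g ∈ T, (g.Monic ∧ Irreducible g) ∧ g.natDegree = n) :
    (∏ g ∈ T, g).natDegree = T.card * n := by
  rw [natDegree_prod_of_monic _ _ fun g hg ↦ (hT g hg).1.1,
    Finset.sum_congr rfl fun g hg ↦ (hT g hg).2, Finset.sum_const, smul_eq_mul]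

end DivisorCount

section Maximal

variable {F : Type} [Field F] [Fintype F]

lemma card_pow_dt1_sub_one_le {s : F[X]} (hs : s.Monic) {n : ℕ} (hn : n ≠ 0) (h : n < dt1 s) :
    Nat.card F ^ n ≤ s.natDegree := by
  rw [← FiniteField.X_pow_card_pow_sub_X_natDegree_eq F hn Finite.one_lt_card,
    ← prod_irredFactors hn]
  refine natDegree_le_of_dvd (prod_dvd_of_forall_dvd (fun g hg ↦ ?_) fun g hg ↦ ?_) hs.ne_zero
  · have := (mem_irredFactors hn).1 hg
    exact ⟨this.2.1, this.1⟩
  · have := (mem_irredFactors hn).1 hg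
    exact dvd_of_natDegree_lt_dt1 this.2.1 this.1
      ((Nat.le_of_dvd (Nat.pos_of_ne_zero hn) this.2.2).trans_lt h)

lemma exists_finset_irreducible {n k : ℕ} (hn : n ≠ 0) (hk : k ≤ numIrred F n) :
    ∃ T : Finset F[X], T.card = k ∧
      ∀ g ∈ T, (g.Monic ∧ Irreducible g) ∧ g.natDegree = n := by
  rw [numIrred_eq_card hn] at hk
  obtain ⟨T, hT, hcard⟩ := Finset.exists_subset_card_eq hk
  refine ⟨T, hcard, fun g hg ↦ ?_⟩
  have := Finset.mem_filter.1 (hT hg)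
  have h1 := (mem_irredFactors hn).1 this.1
  exact ⟨⟨h1.2.1, h1.1⟩, this.2⟩

/-- Exchanging `e` factors of degree `dt1 s - 1` for `dt1 s - 1` factors of degree `e`. -/
lemma IsMaximal.pow_le {m : ℕ} {s : F[X]} (hs : IsMaximal m s) {e R : ℕ} (he : e ≠ 0)
    (hδ : deltaQ F m ≤ e) (hlt : e < dt1 s - 1)
    (hR : ∀ g : F[X], g.Monic → Irreducible g → g.natDegree = e → multiplicity g s ≤ R) :
    (R + 2) ^ (dt1 s - 1) ≤ (R + 1) ^ (dt1 s - 1) * 2 ^ e := by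
  set n := dt1 s - 1
  have hn : n ≠ 0 := by omega
  have hnlog : n ≤ ⌊Real.logb (Fintype.card F) m⌋₊ := by
    have h := card_pow_dt1_sub_one_le hs.1 hn (by omega)
    rw [hs.2.1, Nat.card_eq_fintype_card] at h
    have hq : 1 < Fintype.card F := Fintype.one_lt_card
    have hm : 0 < m := lt_of_lt_of_le (pow_pos (by omega) n) h
    refine Nat.le_floor ?_
    rw [Real.le_logb_iff_rpow_le (by exact_mod_cast hq) (by exact_mod_cast hm), Real.rpow_natCast]
    exact_mod_cast h
  obtain ⟨G, hGcard, hG⟩ := exists_finset_irreducible (F := F) (n := e) (k := n) he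
    (by have := lt_numIrred_of_deltaQ_le hδ; omega)
  obtain ⟨H, hHcard, hH⟩ := exists_finset_irreducible (F := F) (n := n) (k := e) hn
    (by have := lt_numIrred_of_deltaQ_le (hδ.trans hlt.le); omega)
  obtain ⟨w, hw⟩ : ∏ g ∈ H, g ∣ s := prod_dvd_of_forall_dvd (fun g hg ↦ (hH g hg).1) fun g hg ↦
    dvd_of_natDegree_lt_dt1 (hH g hg).1.1 (hH g hg).1.2 (by rw [(hH g hg).2]; omega)
  rw [mul_comm] at hw
  have hHm : (∏ g ∈ H, g).Monic := monic_prod_of_monic _ _ fun g hg ↦ (hH g hg).1.1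
  have hGm : (∏ g ∈ G, g).Monic := monic_prod_of_monic _ _ fun g hg ↦ (hG g hg).1.1
  have hwm : w.Monic := Monic.of_mul_monic_right hHm (hw ▸ hs.1)
  have hdeg : w.natDegree + e * n = m := by
    rw [← hs.2.1, hw, hwm.natDegree_mul hHm, natDegree_prod_of_forall_eq hH, hHcard]
  have h1 := hs.2.2 (w * ∏ g ∈ G, g) (hwm.mul hGm) (by
    rw [hwm.natDegree_mul hGm, natDegree_prod_of_forall_eq hG, hGcard, mul_comm n e, hdeg])
  have h2 := numDiv_mul_prod_le (fun g hg ↦ (hH g hg).1) hwm.ne_zero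
  rw [← hw, hHcard] at h2
  have h3 := pow_mul_numDiv_le (R := R) (fun g hg ↦ (hG g hg).1) hwm.ne_zero fun g hg ↦ by
    refine le_trans ?_ (hR g (hG g hg).1.1 (hG g hg).1.2 (hG g hg).2)
    exact (finiteMultiplicity_of_irreducible (hG g hg).1.2 hs.1.ne_zero).le_multiplicity_of_pow_dvd
      ((pow_multiplicity_dvd g w).trans ⟨_, hw⟩)
  rw [hGcard] at h3
  have hpos := hs.numDiv_pos
  have hW : 0 < numDiv w := Nat.pos_of_mul_pos_left (hpos.trans_le h2)
  refine Nat.le_of_mul_le_mul_right (h3.trans ?_) hW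
  rw [mul_assoc]
  exact Nat.mul_le_mul_left _ (h1.trans h2)

lemma IsMaximal.logb_mul_le {m : ℕ} {s : F[X]} (hs : IsMaximal m s) {e R : ℕ} (he : e ≠ 0)
    (hδ : deltaQ F m ≤ e)
    (hR : ∀ g : F[X], g.Monic → Irreducible g → g.natDegree = e → multiplicity g s ≤ R) :
    Real.logb 2 (((R : ℝ) + 2) / ((R : ℝ) + 1)) * ((dt1 s : ℝ) - 1) ≤ (e : ℝ) := by
  have hR1 : (0 : ℝ) < (R : ℝ) + 1 := by positivity
  have hone : 1 ≤ ((R : ℝ) + 2) / ((R : ℝ) + 1) := by rw [one_le_div hR1]; linarith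
  have hL0 : 0 ≤ Real.logb 2 (((R : ℝ) + 2) / ((R : ℝ) + 1)) :=
    Real.logb_nonneg one_lt_two hone
  rcases lt_or_ge e (dt1 s - 1) with hlt | hge
  · have h := hs.pow_le he hδ hlt hR
    have hcast : ((dt1 s : ℝ) - 1) = ((dt1 s - 1 : ℕ) : ℝ) := by
      rw [Nat.cast_sub (by omega), Nat.cast_one]
    rw [hcast, mul_comm, ← Real.logb_pow, Real.logb_le_iff_le_rpow one_lt_two (by positivity),
      Real.rpow_natCast, div_pow, div_le_iff₀ (by positivity), mul_comm]
    exact_mod_cast h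
  · have hL1 : Real.logb 2 (((R : ℝ) + 2) / ((R : ℝ) + 1)) ≤ 1 := by
      rw [Real.logb_le_iff_le_rpow one_lt_two (by positivity), Real.rpow_one, div_le_iff₀ hR1]
      have : (0 : ℝ) ≤ R := R.cast_nonneg
      linarith
    have hge' : (dt1 s : ℝ) - 1 ≤ e := by
      have : dt1 s ≤ e + 1 := by omega
      have : (dt1 s : ℝ) ≤ e + 1 := by exact_mod_cast this
      linarith
    have : (0 : ℝ) ≤ e := e.cast_nonneg
    nlinarith

end Maximal

/-- Lemma: let `s ∈ M_m` be maximal and `p` a monic irreducible factor of `s` of degree `d`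
with `r = mult_p(s)`. (a) If `d ≥ δ_q(m)` then
`d ≥ log₂((r+3)/(r+2))·(d_{t+1}(s)−1)`. (b) If `d ≥ δ_q(m)−1` then
`d ≥ log₂((r+2)/(r+1))·(d_{t+1}(s)−1) − 1`. -/
theorem maximal_degree_lower_bounds {F : Type} [Field F] [Fintype F]
    (m : ℕ) (hm : 0 < m) (s : F[X]) (hs : IsMaximal m s)
    (p : F[X]) (hp : p.Monic) (hpirr : Irreducible p) (hps : p ∣ s) :
    (deltaQ F m ≤ p.natDegree →
      Real.logb 2 (((multiplicity p s : ℝ) + 3) / ((multiplicity p s : ℝ) + 2)) *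
          ((dt1 s : ℝ) - 1) ≤ (p.natDegree : ℝ)) ∧
    (deltaQ F m - 1 ≤ p.natDegree →
      Real.logb 2 (((multiplicity p s : ℝ) + 2) / ((multiplicity p s : ℝ) + 1)) *
          ((dt1 s : ℝ) - 1) - 1 ≤ (p.natDegree : ℝ)) := by
  have hd := hpirr.natDegree_pos
  constructor
  · intro hδ
    have h := hs.logb_mul_le (R := multiplicity p s + 1) hd.ne' hδ fun g hg hgirr hdeg ↦
      (hs.multiplicity_le hp hpirr hg hgirr).1 hdeg.ge
    push_cast at h
    rw [add_assoc, add_assoc] at h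
    norm_num at h
    exact h
  · intro hδ
    have h := hs.logb_mul_le (R := multiplicity p s) (e := p.natDegree + 1) (by omega) (by omega)
      fun g hg hgirr hdeg ↦ (hs.multiplicity_le hp hpirr hg hgirr).2 (by omega)
    push_cast at h
    linarith
end

section
/- Let s be drawn uniformly at random from M_m and let Φ_m denote the random variable s ↦ Φ(s). Then E[Φ_m] = m + 1 and Var[Φ_m] = ((q − 1)/q)·C(m+1, 3), where C(m+1,3) is the binomial coefficient. Equivalently, Σ_{s ∈ M_m} Φ(s) = (m + 1)·q^m and Σ_{s ∈ M_m} Φ(s)² = q^m·(((q − 1)/q)·C(m+1, 3) + (m + 1)²). -/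
open Polynomial

section

open Finset hiding antidiagonal mem_antidiagonal
open Finset.HasAntidiagonal

theorem Polynomial.finite_monic_natDegree_eq (F : Type) [Field F] [Finite F] (n : ℕ) :
    {s : F[X] | s.Monic ∧ s.natDegree = n}.Finite := by
  have : Finite (degreeLT F n) := Finite.of_equiv _ (degreeLTEquiv F n).symm.toEquiv
  exact Finite.of_equiv _ (monicEquivDegreeLT n).symm

/-- The finset of monic polynomials of degree `n` over a finite field. -/
noncomputable def monicsOfDegree (F : Type) [Field F] [Finite F] (n : ℕ) : Finset F[X] :=
  (finite_monic_natDegree_eq F n).toFinset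

section Factorization

variable {F : Type} [Field F]

theorem Polynomial.Monic.exists_eq_mul_isCoprime {a b : F[X]} (ha : a.Monic) (hb : b.Monic) :
    ∃ h a' b' : F[X], h.Monic ∧ a'.Monic ∧ b'.Monic ∧ IsCoprime a' b' ∧
      h * a' = a ∧ h * b' = b := by
  classical
  have hg : EuclideanDomain.gcd a b ≠ 0 := fun h ↦
    ha.ne_zero (EuclideanDomain.gcd_eq_zero_iff.1 h).1
  set g := EuclideanDomain.gcd a b with hgdef
  have hn : (normalize g).Monic := monic_normalize hg
  obtain ⟨a', ha'⟩ : normalize g ∣ a := normalize_dvd_iff.2 (EuclideanDomain.gcd_dvd_left a b)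
  obtain ⟨b', hb'⟩ : normalize g ∣ b := normalize_dvd_iff.2 (EuclideanDomain.gcd_dvd_right a b)
  refine ⟨normalize g, a', b', hn, hn.of_mul_monic_left (ha' ▸ ha),
    hn.of_mul_monic_left (hb' ▸ hb), ?_, ha'.symm, hb'.symm⟩
  obtain ⟨u, hu⟩ : normalize g ∣ g := normalize_dvd_iff.2 dvd_rfl
  have hunit : IsUnit u := isUnit_of_dvd_one <| by
    obtain ⟨v, hv⟩ : g ∣ normalize g := dvd_normalize_iff.2 dvd_rfl
    refine ⟨v, mul_left_cancel₀ hn.ne_zero ?_⟩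
    rw [← mul_assoc, ← hu, ← hv, mul_one]
  have hbez := EuclideanDomain.gcd_eq_gcd_ab a b
  rw [← hgdef] at hbez
  obtain ⟨v, hv⟩ := hunit.exists_left_inv
  refine ⟨v * EuclideanDomain.gcdA a b, v * EuclideanDomain.gcdB a b, ?_⟩
  refine mul_left_cancel₀ hn.ne_zero ?_
  linear_combination v * (hu - hbez) + normalize g * hv - v * EuclideanDomain.gcdA a b * ha'
    - v * EuclideanDomain.gcdB a b * hb'

theorem Polynomial.Monic.eq_of_mul_eq_mul_of_isCoprime {h k a b a' b' : F[X]}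
    (hh : h.Monic) (hk : k.Monic) (hab : IsCoprime a b) (hab' : IsCoprime a' b')
    (h₁ : h * a = k * a') (h₂ : h * b = k * b') : h = k ∧ a = a' ∧ b = b' := by
  have key : h = k := by
    refine eq_of_monic_of_associated hh hk (associated_of_dvd_dvd ?_ ?_)
    · obtain ⟨u, v, huv⟩ := hab'
      exact ⟨u * a + v * b, by linear_combination -k * huv - u * h₁ - v * h₂⟩
    · obtain ⟨u, v, huv⟩ := hab
      exact ⟨u * a' + v * b', by linear_combination -h * huv + u * h₁ + v * h₂⟩
  subst key
  exact ⟨rfl, mul_left_cancel₀ hh.ne_zero h₁, mul_left_cancel₀ hh.ne_zero h₂⟩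

end Factorization

section Counting

variable {F : Type} [Field F] [Fintype F]

@[simp]
theorem mem_monicsOfDegree {n : ℕ} {s : F[X]} :
    s ∈ monicsOfDegree F n ↔ s.Monic ∧ s.natDegree = n := by
  simp [monicsOfDegree]

theorem card_monicsOfDegree (n : ℕ) : #(monicsOfDegree F n) = Fintype.card F ^ n := by
  rw [← Set.ncard_coe_finset, monicsOfDegree, Set.Finite.coe_toFinset, ← Nat.card_coe_set_eq,
    Set.coe_ofPred, Nat.card_congr ((monicEquivDegreeLT n).trans (degreeLTEquiv F n).toEquiv)]
  simp

variable (F) in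
open Classical in
/-- Pairs of monic polynomials whose degrees add up to `n`. -/
noncomputable def monicPairs (n : ℕ) : Finset (F[X] × F[X]) :=
  (antidiagonal n).biUnion fun p ↦ monicsOfDegree F p.1 ×ˢ monicsOfDegree F p.2

@[simp]
theorem mem_monicPairs {n : ℕ} {p : F[X] × F[X]} :
    p ∈ monicPairs F n ↔
      p.1.Monic ∧ p.2.Monic ∧ p.1.natDegree + p.2.natDegree = n := by
  simp only [monicPairs, mem_biUnion, mem_antidiagonal, mem_product, mem_monicsOfDegree]
  constructor
  · rintro ⟨⟨i, j⟩, rfl, ⟨h₁, rfl⟩, h₂, rfl⟩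
    exact ⟨h₁, h₂, rfl⟩
  · rintro ⟨h₁, h₂, rfl⟩
    exact ⟨(_, _), rfl, ⟨h₁, rfl⟩, h₂, rfl⟩

theorem card_monicPairs (n : ℕ) : #(monicPairs F n) = (n + 1) * Fintype.card F ^ n := by
  classical
  rw [monicPairs, card_biUnion]
  · rw [sum_congr rfl (g := fun _ ↦ Fintype.card F ^ n)]
    · simp
    · intro p hp
      rw [card_product, card_monicsOfDegree, card_monicsOfDegree, ← pow_add,
        mem_antidiagonal.1 hp]
  · intro p _ p' _ hne
    rw [Function.onFun, disjoint_left]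
    rintro ⟨a, b⟩ h h'
    simp only [mem_product, mem_monicsOfDegree] at h h'
    exact hne (Prod.ext (h.1.2.symm.trans h'.1.2) (h.2.2.symm.trans h'.2.2))

variable (F) in
open Classical in
/-- Pairs of coprime monic polynomials whose degrees add up to `n`. -/
noncomputable def coprimeMonicPairs (n : ℕ) : Finset (F[X] × F[X]) :=
  {p ∈ monicPairs F n | IsCoprime p.1 p.2}

@[simp]
theorem mem_coprimeMonicPairs {n : ℕ} {p : F[X] × F[X]} :
    p ∈ coprimeMonicPairs F n ↔
      (p.1.Monic ∧ p.2.Monic ∧ p.1.natDegree + p.2.natDegree = n) ∧ IsCoprime p.1 p.2 := by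
  simp [coprimeMonicPairs]

theorem card_monicPairs_eq_sum (n : ℕ) :
    #(monicPairs F n) =
      ∑ k ∈ range (n / 2 + 1), Fintype.card F ^ k * #(coprimeMonicPairs F (n - 2 * k)) := by
  simp_rw [← card_monicsOfDegree, ← card_product]
  rw [← card_sigma]
  symm
  refine card_bij (fun x _ ↦ (x.2.1 * x.2.2.1, x.2.1 * x.2.2.2)) ?_ ?_ ?_
  · rintro ⟨k, h, a, b⟩ hx
    simp only [mem_sigma, mem_range, mem_product, mem_monicsOfDegree,
      mem_coprimeMonicPairs] at hx
    obtain ⟨hk, ⟨hh, hhd⟩, ⟨ha, hb, hd⟩, -⟩ := hx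
    simp only [mem_monicPairs]
    refine ⟨hh.mul ha, hh.mul hb, ?_⟩
    rw [hh.natDegree_mul ha, hh.natDegree_mul hb]
    omega
  · rintro ⟨k, h, a, b⟩ hx ⟨k', h', a', b'⟩ hx' heq
    simp only [mem_sigma, mem_range, mem_product, mem_monicsOfDegree,
      mem_coprimeMonicPairs] at hx hx'
    obtain ⟨hk, ⟨hh, rfl⟩, -, hc⟩ := hx
    obtain ⟨hk', ⟨hh', rfl⟩, -, hc'⟩ := hx'
    obtain ⟨h₁, h₂⟩ := Prod.mk.inj heq
    obtain ⟨rfl, rfl, rfl⟩ := hh.eq_of_mul_eq_mul_of_isCoprime hh' hc hc' h₁ h₂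
    rfl
  · rintro ⟨a, b⟩ hp
    obtain ⟨ha, hb, hd⟩ := mem_monicPairs.1 hp
    obtain ⟨h, a', b', hh, ha', hb', hc, rfl, rfl⟩ := ha.exists_eq_mul_isCoprime hb
    simp only [hh.natDegree_mul ha', hh.natDegree_mul hb'] at hd
    refine ⟨⟨h.natDegree, h, a', b'⟩, ?_, rfl⟩
    simp only [mem_sigma, mem_range, mem_product, mem_monicsOfDegree, mem_coprimeMonicPairs]
    exact ⟨by omega, ⟨hh, trivial⟩, ⟨ha', hb', by omega⟩, hc⟩

theorem card_monicPairs_add_two (n : ℕ) :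
    #(monicPairs F (n + 2)) =
      #(coprimeMonicPairs F (n + 2)) + Fintype.card F * #(monicPairs F n) := by
  rw [card_monicPairs_eq_sum (n + 2), card_monicPairs_eq_sum n, mul_sum,
    show (n + 2) / 2 + 1 = (n / 2 + 1) + 1 by omega, sum_range_succ', add_comm]
  congr 1
  · simp
  · refine sum_congr rfl fun k _ ↦ ?_
    rw [show n + 2 - 2 * (k + 1) = n - 2 * k by omega]
    ring

theorem card_coprimeMonicPairs (n : ℕ) :
    (#(coprimeMonicPairs F n) : ℝ) =
      Fintype.card F ^ n * ((n + 1) - (n - 1 : ℕ) / Fintype.card F) := by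
  have hq : (Fintype.card F : ℝ) ≠ 0 := by simp
  match n with
  | 0 =>
    have := card_monicPairs_eq_sum (F := F) 0
    simp [card_monicPairs] at this
    simp [← this]
  | 1 =>
    have := card_monicPairs_eq_sum (F := F) 1
    simp [card_monicPairs] at this
    simp [← this]
    ring
  | n + 2 =>
    have := card_monicPairs_add_two (F := F) n
    rw [card_monicPairs, card_monicPairs] at this
    have : ((n + 2 + 1) * Fintype.card F ^ (n + 2) : ℝ) = #(coprimeMonicPairs F (n + 2)) +
      Fintype.card F * ((n + 1) * Fintype.card F ^ n) := mod_cast this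
    rw [eq_sub_of_add_eq this.symm]
    simp only [Nat.add_succ_sub_one]
    push_cast
    field_simp
    ring

open Classical in
/-- The finset of monic divisors of degree at most `s.natDegree`, that is, of all monic divisors
if `s ≠ 0`. -/
noncomputable def monicDivisors (s : F[X]) : Finset F[X] :=
  {d ∈ (range (s.natDegree + 1)).biUnion (monicsOfDegree F) | d ∣ s}

theorem mem_monicDivisors {s d : F[X]} (hs : s ≠ 0) :
    d ∈ monicDivisors s ↔ d.Monic ∧ d ∣ s := by
  simp only [monicDivisors, mem_filter, mem_biUnion, mem_range, mem_monicsOfDegree]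
  constructor
  · rintro ⟨⟨_, _, h, _⟩, hd⟩
    exact ⟨h, hd⟩
  · rintro ⟨h, hd⟩
    exact ⟨⟨_, Nat.lt_succ_of_le (natDegree_le_of_dvd hd hs), h, rfl⟩, hd⟩

theorem numDiv_eq_card_monicDivisors {s : F[X]} (hs : s ≠ 0) :
    numDiv s = #(monicDivisors s) := by
  rw [numDiv, ← Set.ncard_coe_finset]
  congr 1
  ext d
  simp [mem_monicDivisors hs]

theorem sum_numDiv (m : ℕ) :
    ∑ s ∈ monicsOfDegree F m, numDiv s = #(monicPairs F m) := by
  rw [sum_congr rfl fun s hs ↦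
    numDiv_eq_card_monicDivisors (mem_monicsOfDegree.1 hs).1.ne_zero, ← card_sigma]
  symm
  refine card_bij (fun p _ ↦ ⟨p.1 * p.2, p.1⟩) ?_ ?_ ?_
  · rintro ⟨a, b⟩ hp
    obtain ⟨ha, hb, hd⟩ := mem_monicPairs.1 hp
    simp only [mem_sigma, mem_monicsOfDegree, mem_monicDivisors (ha.mul hb).ne_zero]
    exact ⟨⟨ha.mul hb, (ha.natDegree_mul hb).trans hd⟩, ha, dvd_mul_right _ _⟩
  · rintro ⟨a, b⟩ hp ⟨a', b'⟩ hp' heq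
    obtain ⟨ha, -, -⟩ := mem_monicPairs.1 hp
    simp only [Sigma.mk.injEq, heq_eq_eq] at heq
    obtain ⟨h, rfl⟩ := heq
    rw [mul_left_cancel₀ ha.ne_zero h]
  · rintro ⟨s, a⟩ hx
    simp only [mem_sigma, mem_monicsOfDegree] at hx
    obtain ⟨⟨hs, hsd⟩, hmem⟩ := hx
    obtain ⟨ha, b, rfl⟩ := (mem_monicDivisors hs.ne_zero).1 hmem
    have hb := ha.of_mul_monic_left hs
    exact ⟨(a, b), mem_monicPairs.2 ⟨ha, hb, ha.natDegree_mul hb ▸ hsd⟩, rfl⟩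

theorem sum_numDiv_sq (m : ℕ) :
    ∑ s ∈ monicsOfDegree F m, numDiv s ^ 2 =
      ∑ p ∈ antidiagonal m, #(monicPairs F p.1) * #(coprimeMonicPairs F p.2) := by
  rw [sum_congr rfl fun s hs ↦ congrArg (· ^ 2)
    (numDiv_eq_card_monicDivisors (mem_monicsOfDegree.1 hs).1.ne_zero)]
  simp_rw [sq, ← card_product]
  rw [← card_sigma, ← card_sigma]
  symm
  refine card_bij (fun x _ ↦ ⟨x.2.1.1 * x.2.1.2 * (x.2.2.1 * x.2.2.2),
    (x.2.1.1 * x.2.2.1, x.2.1.1 * x.2.2.2)⟩) ?_ ?_ ?_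
  · rintro ⟨⟨i, j⟩, ⟨g, c⟩, a, b⟩ hx
    simp only [mem_sigma, mem_antidiagonal, mem_product, mem_monicPairs,
      mem_coprimeMonicPairs] at hx
    obtain ⟨hij, ⟨hg, hc, hi⟩, ⟨ha, hb, hj⟩, -⟩ := hx
    have hs := (hg.mul hc).mul (ha.mul hb)
    simp only [mem_sigma, mem_product, mem_monicsOfDegree, mem_monicDivisors hs.ne_zero]
    refine ⟨⟨hs, ?_⟩, ⟨hg.mul ha, c * b, by ring⟩, hg.mul hb, c * a, by ring⟩
    rw [(hg.mul hc).natDegree_mul (ha.mul hb), hg.natDegree_mul hc, ha.natDegree_mul hb]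
    omega
  · rintro ⟨⟨i, j⟩, ⟨g, c⟩, a, b⟩ hx ⟨⟨i', j'⟩, ⟨g', c'⟩, a', b'⟩ hx' heq
    simp only [mem_sigma, mem_antidiagonal, mem_product, mem_monicPairs,
      mem_coprimeMonicPairs] at hx hx'
    obtain ⟨-, ⟨hg, -, rfl⟩, ⟨ha, hb, rfl⟩, hab⟩ := hx
    obtain ⟨-, ⟨hg', -, rfl⟩, ⟨-, -, rfl⟩, hab'⟩ := hx'
    simp only [Sigma.mk.injEq, heq_eq_eq, Prod.mk.injEq] at heq
    obtain ⟨hs, h₁, h₂⟩ := heq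
    obtain ⟨rfl, rfl, rfl⟩ := hg.eq_of_mul_eq_mul_of_isCoprime hg' hab hab' h₁ h₂
    obtain rfl := mul_left_cancel₀ hg.ne_zero (mul_right_cancel₀ (ha.mul hb).ne_zero hs)
    rfl
  · rintro ⟨s, d, e⟩ hx
    simp only [mem_sigma, mem_product, mem_monicsOfDegree] at hx
    obtain ⟨⟨hs, hsd⟩, hdmem, hemem⟩ := hx
    obtain ⟨hd, hds⟩ := (mem_monicDivisors hs.ne_zero).1 hdmem
    obtain ⟨he, hes⟩ := (mem_monicDivisors hs.ne_zero).1 hemem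
    obtain ⟨g, a, b, hg, ha, hb, hab, rfl, rfl⟩ := hd.exists_eq_mul_isCoprime he
    obtain ⟨t, rfl⟩ : g ∣ s := (dvd_mul_right g a).trans hds
    obtain ⟨c, rfl⟩ : a * b ∣ t := hab.mul_dvd
      ((mul_dvd_mul_iff_left hg.ne_zero).1 hds) ((mul_dvd_mul_iff_left hg.ne_zero).1 hes)
    have hc := (ha.mul hb).of_mul_monic_left (hg.of_mul_monic_left hs)
    rw [hg.natDegree_mul ((ha.mul hb).mul hc), (ha.mul hb).natDegree_mul hc,
      ha.natDegree_mul hb] at hsd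
    refine ⟨⟨(g.natDegree + c.natDegree, a.natDegree + b.natDegree), (g, c), a, b⟩, ?_, ?_⟩
    · simp only [mem_sigma, mem_antidiagonal, mem_product, mem_monicPairs,
        mem_coprimeMonicPairs]
      exact ⟨by omega, ⟨hg, hc, trivial⟩, ⟨ha, hb, trivial⟩, hab⟩
    · simp only [Sigma.mk.injEq, heq_eq_eq, and_true]
      ring

end Counting

section Sums

theorem sum_antidiagonal_succ_mul {R : Type*} [CommSemiring R] (f : ℕ → R) (m : ℕ) :
    ∑ p ∈ antidiagonal (m + 1), ((p.1 : R) + 1) * f p.2 =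
      ∑ p ∈ antidiagonal m, ((p.1 : R) + 1) * f p.2 + ∑ j ∈ range (m + 2), f j := by
  have h : ∑ p ∈ antidiagonal m, f p.2 = ∑ j ∈ range (m + 1), f j := by
    rw [← Nat.sum_antidiagonal_swap]
    exact Nat.sum_antidiagonal_eq_sum_range_succ_mk _ _
  rw [Nat.sum_antidiagonal_succ, sum_range_succ _ (m + 1), ← h]
  simp only [Nat.cast_succ, add_mul _ (1 : R), sum_add_distrib]
  simp
  ring

theorem sum_antidiagonal_succ_mul_succ (m : ℕ) :
    ∑ p ∈ antidiagonal m, ((p.1 : ℝ) + 1) * ((p.2 : ℝ) + 1) =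
      (m + 1) * (m + 2) * (m + 3) / 6 := by
  have h (n : ℕ) : ∑ j ∈ range n, ((j : ℝ) + 1) = n * (n + 1) / 2 := by
    induction n with
    | zero => simp
    | succ n ih => rw [sum_range_succ, ih]; push_cast; ring
  induction m with
  | zero => norm_num
  | succ m ih =>
    rw [sum_antidiagonal_succ_mul (fun j ↦ (j : ℝ) + 1), ih, h]
    push_cast
    ring

theorem sum_antidiagonal_succ_mul_pred (m : ℕ) :
    ∑ p ∈ antidiagonal m, ((p.1 : ℝ) + 1) * ((p.2 - 1 : ℕ) : ℝ) =
      (m + 1) * m * (m - 1) / 6 := by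
  have h (n : ℕ) : ∑ j ∈ range (n + 1), ((j - 1 : ℕ) : ℝ) = n * (n - 1) / 2 := by
    induction n with
    | zero => simp
    | succ n ih => rw [sum_range_succ, ih]; push_cast [Nat.add_sub_cancel]; ring
  induction m with
  | zero => simp
  | succ m ih =>
    rw [sum_antidiagonal_succ_mul (fun j ↦ ((j - 1 : ℕ) : ℝ)), ih, h]
    push_cast
    ring

theorem Nat.cast_succ_choose_three (m : ℕ) :
    ((m + 1).choose 3 : ℝ) = (m + 1) * m * (m - 1) / 6 := by
  induction m with
  | zero => simp [Nat.choose]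
  | succ m ih =>
    rw [Nat.choose_succ_succ, Nat.cast_add, ih, Nat.cast_choose_two]
    push_cast
    ring

end Sums

end

/-- Theorem 4: for `s` uniform on `M_m` (with `|M_m| = q^m`), `E[Φ_m] = m + 1` and
`Var[Φ_m] = ((q−1)/q)·C(m+1,3)`; equivalently,
`Σ_{s ∈ M_m} Φ(s) = (m+1)·q^m` and
`Σ_{s ∈ M_m} Φ(s)² = q^m·(((q−1)/q)·C(m+1,3) + (m+1)²)`. -/
theorem expectation_variance_numDiv {F : Type} [Field F] [Fintype F]
    (m : ℕ) (hm : 0 < m) :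
    (∑ᶠ s ∈ {s : F[X] | s.Monic ∧ s.natDegree = m}, (numDiv s : ℝ)) =
        ((m : ℝ) + 1) * (Fintype.card F : ℝ) ^ m ∧
    (∑ᶠ s ∈ {s : F[X] | s.Monic ∧ s.natDegree = m}, (numDiv s : ℝ) ^ 2) =
        (Fintype.card F : ℝ) ^ m *
          ((((Fintype.card F : ℝ) - 1) / (Fintype.card F : ℝ)) *
              ((m + 1).choose 3 : ℝ) + ((m : ℝ) + 1) ^ 2) := by
  have hq : (Fintype.card F : ℝ) ≠ 0 := by simp
  rw [finsum_mem_eq_finite_toFinset_sum _ (finite_monic_natDegree_eq F m),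
    finsum_mem_eq_finite_toFinset_sum _ (finite_monic_natDegree_eq F m)]
  constructor
  · have h := sum_numDiv (F := F) m
    rw [card_monicPairs] at h
    exact_mod_cast h
  · have h : ∑ s ∈ monicsOfDegree F m, (numDiv s : ℝ) ^ 2 =
        ∑ p ∈ Finset.HasAntidiagonal.antidiagonal m,
          ((monicPairs F p.1).card : ℝ) * ((coprimeMonicPairs F p.2).card : ℝ) :=
      mod_cast sum_numDiv_sq (F := F) m
    have hterm : ∀ p ∈ Finset.HasAntidiagonal.antidiagonal m,
        ((monicPairs F p.1).card : ℝ) * ((coprimeMonicPairs F p.2).card : ℝ) =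
          (Fintype.card F : ℝ) ^ m * (((p.1 : ℝ) + 1) * ((p.2 : ℝ) + 1) -
            ((p.1 : ℝ) + 1) * ((p.2 - 1 : ℕ) : ℝ) / Fintype.card F) := by
      intro p hp
      rw [card_coprimeMonicPairs, card_monicPairs,
        ← Finset.HasAntidiagonal.mem_antidiagonal.1 hp, pow_add]
      push_cast
      ring
    rw [Finset.sum_congr rfl hterm, ← Finset.mul_sum, Finset.sum_sub_distrib,
      ← Finset.sum_div, sum_antidiagonal_succ_mul_succ, sum_antidiagonal_succ_mul_pred] at h
    refine h.trans ?_
    rw [Nat.cast_succ_choose_three]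
    field_simp
    ring
end
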